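/- arXiv:1002.4019 — 5 statements merged into one kernel-verified Lean document; each statement's English description precedes it below -/
import Mathlib

section
/- Let λ > 1 and set α := 1/(1 + log₂ λ). For any full binary tree T whose leaves are labeled bijectively by the objects of Θ, the following exact identity holds: Σ_{i=1}^M π_i λ^{d_i} = λ^{H_α(Π)} + Σ_{a ∈ I} π_{Θ_a} [ (λ − 1) λ^{d_a} − D_α(Θ_a) + (π_{Θ_{l(a)}}/π_{Θ_a}) D_α(Θ_{l(a)}) + (π_{Θ_{r(a)}}/π_{Θ_a}) D_α(Θ_{r(a)}) ]. Equivalently, the exponential query cost L_λ(Π) := log_λ(Σ_i π_i λ^{d_i}) equals log_λ of the right-hand side, exhibiting the exact gap in Campbell's Rényi-entropy lower bound. -/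
/-- A full binary decision tree with leaves labeled by elements of `ι`. -/
inductive BTree (ι : Type) : Type where
  | leaf : ι → BTree ι
  | node : BTree ι → BTree ι → BTree ι

namespace BTree

variable {ι : Type}

/-- The list of leaf labels of a tree. -/
def leaves : BTree ι → List ι
  | .leaf a => [a]
  | .node l r => leaves l ++ leaves r

/-- The list of leaf labels together with their depths (root has depth 0). -/
def leavesD : BTree ι → List (ι × ℕ)
  | .leaf a => [(a, 0)]
  | .node l r => (leavesD l ++ leavesD r).map fun p => (p.1, p.2 + 1)

/-- The list of internal nodes (as subtrees) together with their depths. -/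
def internals : BTree ι → List (BTree ι × ℕ)
  | .leaf _ => []
  | .node l r => (.node l r, 0) :: ((internals l ++ internals r).map fun p => (p.1, p.2 + 1))

/-- Left child (identity on leaves). -/
def left : BTree ι → BTree ι
  | .leaf a => .leaf a
  | .node l _ => l

/-- Right child (identity on leaves). -/
def right : BTree ι → BTree ι
  | .leaf a => .leaf a
  | .node _ r => r

/-- `mass π t` is the total prior probability of the objects at the leaves of `t`,
i.e. `π_{Θ_a}` for the node `a` rooting `t`. -/
def mass (π : ι → ℝ) (t : BTree ι) : ℝ := (t.leaves.map π).sum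

end BTree

/-- `Dalpha π α t` is `D_α(Θ_a) = (∑_{θ_i ∈ Θ_a} (π_i/π_{Θ_a})^α)^{1/α}`
for the node `a` rooting the subtree `t`. -/
noncomputable def Dalpha {ι : Type} (π : ι → ℝ) (α : ℝ) (t : BTree ι) : ℝ :=
  ((t.leaves.map fun i => (π i / BTree.mass π t) ^ α).sum) ^ (1 / α)

theorem BTree.mass_node {ι : Type} (π : ι → ℝ) (l r : BTree ι) :
    BTree.mass π (.node l r) = BTree.mass π l + BTree.mass π r := by
  simp [BTree.mass, BTree.leaves]

theorem BTree.mass_pos {ι : Type} {π : ι → ℝ} (hπ : ∀ i, 0 < π i) (t : BTree ι) :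
    0 < BTree.mass π t := by
  induction t with
  | leaf a => simpa [BTree.mass, BTree.leaves] using hπ a
  | node l r ihl ihr => rw [BTree.mass_node]; exact add_pos ihl ihr

/-- The gap identity with all powers of `lam` scaled by a constant `c`, for an arbitrary functional
`D` on trees that equals `1` on leaves. -/
theorem BTree.scaled_cost_identity {ι : Type} {π : ι → ℝ} (hπ : ∀ i, 0 < π i) (lam : ℝ)
    {D : BTree ι → ℝ} (hD : ∀ i, D (.leaf i) = 1) (t : BTree ι) (c : ℝ) :
    (t.leavesD.map fun p => π p.1 * (c * lam ^ p.2)).sum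
      = BTree.mass π t * D t + (c - 1) * BTree.mass π t
        + (t.internals.map fun p =>
            BTree.mass π p.1 *
              ((lam - 1) * (c * lam ^ p.2) - D p.1
                + (BTree.mass π p.1.left / BTree.mass π p.1) * D p.1.left
                + (BTree.mass π p.1.right / BTree.mass π p.1) * D p.1.right)).sum := by
  induction t generalizing c with
  | leaf a =>
    simp [BTree.leavesD, BTree.internals, BTree.mass, BTree.leaves, hD]
    ring
  | node l r ihl ihr =>
    have hm := (BTree.mass_pos hπ (.node l r)).ne'
    have hpow (d : ℕ) : c * lam ^ (d + 1) = c * lam * lam ^ d := by ring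
    simp only [BTree.leavesD, BTree.internals, List.map_append, List.map_map, List.map_cons,
      List.sum_append, List.sum_cons, Function.comp_def, hpow, ihl, ihr, BTree.left,
      BTree.right, pow_zero]
    field_simp
    rw [BTree.mass_node]
    ring

theorem rpow_mul_logb_eq_rpow {lam α S : ℝ} (hlam : 1 < lam)
    (hα : α = 1 / (1 + Real.logb 2 lam)) (hS : 0 < S) :
    lam ^ ((1 / (1 - α)) * Real.logb 2 S) = S ^ (1 / α) := by
  have hL : 0 < Real.logb 2 lam := Real.logb_pos one_lt_two hlam
  have hexp : Real.logb 2 lam * ((1 / (1 - α)) * Real.logb 2 S)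
      = Real.logb 2 S * (1 / α) := by
    have h : 1 - α = Real.logb 2 lam / (1 + Real.logb 2 lam) := by
      rw [hα]; field_simp; ring
    rw [h, hα]
    field_simp
  have hlam' : (2 : ℝ) ^ Real.logb 2 lam = lam :=
    Real.rpow_logb two_pos (by norm_num) (by linarith)
  have hS' : (2 : ℝ) ^ Real.logb 2 S = S := Real.rpow_logb two_pos (by norm_num) hS
  calc lam ^ ((1 / (1 - α)) * Real.logb 2 S)
      = ((2 : ℝ) ^ Real.logb 2 lam) ^ ((1 / (1 - α)) * Real.logb 2 S) := by rw [hlam']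
    _ = ((2 : ℝ) ^ Real.logb 2 S) ^ (1 / α) := by
      rw [← Real.rpow_mul two_pos.le, hexp, Real.rpow_mul two_pos.le]
    _ = S ^ (1 / α) := by rw [hS']

theorem List.sum_map_eq_sum_univ {ι : Type} [Fintype ι] {s : List ι} (hs : s.Nodup)
    (hall : ∀ i, i ∈ s) (f : ι → ℝ) : (s.map f).sum = ∑ i, f i := by
  classical
  rw [← List.sum_toFinset f hs]
  congr 1
  ext i
  simp [hall]

/-- **Theorem 1 (object identification).** For `λ > 1` and `α = 1/(1 + log₂ λ)`,
the exponential query cost satisfies the exact identity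
`∑ᵢ πᵢ λ^{dᵢ} = λ^{H_α(Π)} + ∑_{a ∈ I} π_{Θ_a} [(λ-1)λ^{d_a} - D_α(Θ_a)
  + (π_{Θ_{l(a)}}/π_{Θ_a}) D_α(Θ_{l(a)}) + (π_{Θ_{r(a)}}/π_{Θ_a}) D_α(Θ_{r(a)})]`. -/
theorem exponential_cost_identity {M : ℕ} (π : Fin M → ℝ)
    (hπ : ∀ i, 0 < π i) (hsum : ∑ i, π i = 1)
    (lam : ℝ) (hlam : 1 < lam) (α : ℝ) (hα : α = 1 / (1 + Real.logb 2 lam))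
    (T : BTree (Fin M)) (hnodup : T.leaves.Nodup) (hall : ∀ i, i ∈ T.leaves) :
    (T.leavesD.map fun p => π p.1 * lam ^ p.2).sum
      = lam ^ ((1 / (1 - α)) * Real.logb 2 (∑ i, π i ^ α))
        + (T.internals.map fun p =>
            BTree.mass π p.1 *
              ((lam - 1) * lam ^ p.2 - Dalpha π α p.1
                + (BTree.mass π p.1.left / BTree.mass π p.1) * Dalpha π α p.1.left
                + (BTree.mass π p.1.right / BTree.mass π p.1) * Dalpha π α p.1.right)).sum := by
  have hD (i : Fin M) : Dalpha π α (.leaf i) = 1 := by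
    simp [Dalpha, BTree.mass, BTree.leaves, (hπ i).ne']
  have hmass : BTree.mass π T = 1 := by
    rw [BTree.mass, List.sum_map_eq_sum_univ hnodup hall, hsum]
  have hne : (Finset.univ : Finset (Fin M)).Nonempty := by
    rw [Finset.nonempty_iff_ne_empty]
    rintro h
    simp [h] at hsum
  have hS : 0 < ∑ i, π i ^ α :=
    Finset.sum_pos (fun i _ => Real.rpow_pos_of_pos (hπ i) α) hne
  have hDT : Dalpha π α T = (∑ i, π i ^ α) ^ (1 / α) := by
    simp only [Dalpha, hmass, div_one, List.sum_map_eq_sum_univ hnodup hall]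
  have h := BTree.scaled_cost_identity hπ lam hD T 1
  simp only [one_mul, sub_self, zero_mul, add_zero, hmass] at h
  rw [rpow_mul_logb_eq_rpow hlam hα hS, ← hDT]
  exact h
end

section
/- For any full binary tree T whose leaves are labeled bijectively by the objects of Θ, the expected number of queries (expected leaf depth) satisfies the exact identity Σ_{i=1}^M π_i d_i = H(Π) + Σ_{a ∈ I} π_{Θ_a} [ 1 − H(ρ_a) ], where H(Π) is the Shannon entropy of the prior and ρ_a is the reduction factor at internal node a. -/
/-- Binary (Shannon) entropy of a proportion `ρ`, in bits; `Real.logb 2 0 = 0`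
gives the convention `0 log₂ 0 = 0`. -/
noncomputable def binEnt (ρ : ℝ) : ℝ := -(ρ * Real.logb 2 ρ) - (1 - ρ) * Real.logb 2 (1 - ρ)

/-- The reduction factor `ρ_a = max(π_{Θ_{l(a)}}, π_{Θ_{r(a)}})/π_{Θ_a}` at the node
rooting the subtree `t`. -/
noncomputable def redFactor {ι : Type} (π : ι → ℝ) (t : BTree ι) : ℝ :=
  max (BTree.mass π t.left) (BTree.mass π t.right) / BTree.mass π t

lemma binEnt_one_sub (ρ : ℝ) : binEnt (1 - ρ) = binEnt ρ := by
  unfold binEnt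
  rw [sub_sub_cancel]
  ring

/-- Grouping property of the entropy, for two unnormalized masses. -/
lemma add_mul_binEnt_div {x y : ℝ} (hx : 0 < x) (hy : 0 < y) :
    (x + y) * binEnt (x / (x + y)) =
      (x + y) * Real.logb 2 (x + y) - x * Real.logb 2 x - y * Real.logb 2 y := by
  have hxy : x + y ≠ 0 := by positivity
  have h : 1 - x / (x + y) = y / (x + y) := by
    field_simp
    ring
  unfold binEnt
  rw [h, Real.logb_div hx.ne' hxy, Real.logb_div hy.ne' hxy]
  field_simp
  ring

namespace BTree

variable {ι : Type}

lemma mass_node_s1 (π : ι → ℝ) (l r : BTree ι) :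
    mass π (.node l r) = mass π l + mass π r := by
  simp [mass, leaves]

lemma mass_pos_s1 {π : ι → ℝ} (hπ : ∀ i, 0 < π i) (t : BTree ι) : 0 < mass π t := by
  induction t with
  | leaf a => simpa [mass, leaves] using hπ a
  | node l r hl hr =>
    rw [mass_node_s1]
    exact add_pos hl hr

lemma binEnt_redFactor_node {π : ι → ℝ} (hπ : ∀ i, 0 < π i) (l r : BTree ι) :
    binEnt (redFactor π (.node l r)) = binEnt (mass π l / (mass π l + mass π r)) := by
  have hne : mass π l + mass π r ≠ 0 := (add_pos (mass_pos_s1 hπ l) (mass_pos_s1 hπ r)).ne'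
  simp only [redFactor, left, right, mass_node_s1]
  rcases le_total (mass π l) (mass π r) with h | h
  · rw [max_eq_right h, ← binEnt_one_sub]
    congr 1
    field_simp
    ring
  · rw [max_eq_left h]

lemma sum_leavesD_fst (π : ι → ℝ) (t : BTree ι) :
    (t.leavesD.map fun p => π p.1).sum = mass π t := by
  induction t with
  | leaf a => simp [leavesD, mass, leaves]
  | node l r hl hr => simp [leavesD, mass_node_s1, Function.comp_def, hl, hr]

lemma sum_leavesD_node (π : ι → ℝ) (l r : BTree ι) :
    ((BTree.node l r).leavesD.map fun p => π p.1 * (p.2 : ℝ)).sum =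
      (l.leavesD.map fun p => π p.1 * (p.2 : ℝ)).sum +
        (r.leavesD.map fun p => π p.1 * (p.2 : ℝ)).sum + mass π (.node l r) := by
  simp only [leavesD, List.map_append, List.map_map, Function.comp_def, List.sum_append,
    Nat.cast_add, Nat.cast_one, mul_add, mul_one, List.sum_map_add, sum_leavesD_fst, mass_node_s1]
  ring

/-- The expected-depth identity for an unnormalized positive weight. -/
lemma sum_mul_depth_eq {π : ι → ℝ} (hπ : ∀ i, 0 < π i) (t : BTree ι) :
    (t.leavesD.map fun p => π p.1 * (p.2 : ℝ)).sum =
      mass π t * Real.logb 2 (mass π t) - (t.leaves.map fun i => π i * Real.logb 2 (π i)).sum +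
        (t.internals.map fun p => mass π p.1 * (1 - binEnt (redFactor π p.1))).sum := by
  induction t with
  | leaf a => simp [leavesD, mass, leaves, internals]
  | node l r hl hr =>
    rw [sum_leavesD_node, hl, hr]
    simp only [internals, leaves, List.map_cons, List.map_append, List.map_map,
      Function.comp_def, List.sum_cons, List.sum_append, binEnt_redFactor_node hπ, mass_node_s1]
    linarith [add_mul_binEnt_div (mass_pos_s1 hπ l) (mass_pos_s1 hπ r)]

end BTree

/-- A duplicate-free list exhausting a finite type computes sums over that type. -/
lemma List.Nodup.sum_map_eq_sum_univ {ι R : Type*} [Fintype ι] [AddCommMonoid R]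
    {L : List ι} (hL : L.Nodup) (h : ∀ i, i ∈ L) (f : ι → R) : (L.map f).sum = ∑ i, f i := by
  classical
  rw [← List.sum_toFinset f hL, (Finset.eq_univ_iff_forall.2 fun i => List.mem_toFinset.2 (h i))]

/-- **Corollary (average case).** The expected number of queries satisfies the exact identity
`∑ᵢ πᵢ dᵢ = H(Π) + ∑_{a ∈ I} π_{Θ_a} [1 - H(ρ_a)]`. -/
theorem expected_depth_identity {M : ℕ} (π : Fin M → ℝ)
    (hπ : ∀ i, 0 < π i) (hsum : ∑ i, π i = 1)
    (T : BTree (Fin M)) (hnodup : T.leaves.Nodup) (hall : ∀ i, i ∈ T.leaves) :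
    (T.leavesD.map fun p => π p.1 * (p.2 : ℝ)).sum
      = (- ∑ i, π i * Real.logb 2 (π i))
        + (T.internals.map fun p => BTree.mass π p.1 * (1 - binEnt (redFactor π p.1))).sum := by
  have hmass : BTree.mass π T = 1 := (hnodup.sum_map_eq_sum_univ hall π).trans hsum
  rw [BTree.sum_mul_depth_eq hπ, hmass, hnodup.sum_map_eq_sum_univ hall]
  simp
end

section
/- Let A and B be disjoint nonempty finite sets of objects with positive weights π_i, and put π_A := Σ_{i∈A} π_i, π_B := Σ_{i∈B} π_i. For λ > 1 set α(λ) := 1/(1 + log₂ λ). Then lim_{λ→∞} log_λ( (π_A/(π_A+π_B)) · (Σ_{i∈A} (π_i/π_A)^{α(λ)})^{1/α(λ)} + (π_B/(π_A+π_B)) · (Σ_{i∈B} (π_i/π_B)^{α(λ)})^{1/α(λ)} ) = max( log₂ |A|, log₂ |B| ). Consequently, in the limit λ → ∞, minimizing this node-splitting cost over queries is equivalent to minimizing max(|A|, |B|), i.e., λ-GBS reduces to generalized binary search with the uniform prior. -/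
/-- `alphaOf λ = 1/(1 + log₂ λ)`, the Rényi order associated with the exponential
cost parameter `λ`. -/
noncomputable def alphaOf (lam : ℝ) : ℝ := 1 / (1 + Real.logb 2 lam)

/-- `Dcost π S α = (∑_{i ∈ S} (π_i/π_S)^α)^{1/α}`, the Rényi diversity of the
weighted set `S`. -/
noncomputable def Dcost {ι : Type} (π : ι → ℝ) (S : Finset ι) (α : ℝ) : ℝ :=
  (∑ i ∈ S, (π i / ∑ j ∈ S, π j) ^ α) ^ (1 / α)

open Filter Topology

/-- On the logarithmic scale, a sum is asymptotic to the maximum of its terms. -/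
theorem tendsto_log_add_div_max {β : Type*} {l : Filter β} {L u v : β → ℝ} {x y : ℝ}
    (hL : Tendsto L l atTop) (hu : ∀ t, 0 < u t) (hv : ∀ t, 0 < v t)
    (hx : Tendsto (fun t => Real.log (u t) / L t) l (𝓝 x))
    (hy : Tendsto (fun t => Real.log (v t) / L t) l (𝓝 y)) :
    Tendsto (fun t => Real.log (u t + v t) / L t) l (𝓝 (max x y)) := by
  have hm := hx.max hy
  have hup : Tendsto (fun t => max (Real.log (u t) / L t) (Real.log (v t) / L t)
      + Real.log 2 / L t) l (𝓝 (max x y)) := by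
    simpa using hm.add (hL.const_div_atTop (Real.log 2))
  refine tendsto_of_tendsto_of_tendsto_of_le_of_le' hm hup ?_ ?_
  · filter_upwards [hL.eventually_gt_atTop 0] with t ht
    have := hu t
    have := hv t
    refine max_le ?_ ?_ <;> gcongr <;> linarith
  · filter_upwards [hL.eventually_gt_atTop 0] with t ht
    have key : ∀ a b : ℝ, 0 < a → 0 < b → a ≤ b →
        Real.log (a + b) / L t ≤ Real.log b / L t + Real.log 2 / L t := by
      intro a b ha hb hab
      rw [← add_div, ← Real.log_mul hb.ne' two_ne_zero]
      gcongr
      linarith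
    rcases le_total (u t) (v t) with h | h
    · exact (key _ _ (hu t) (hv t) h).trans (by gcongr; exact le_max_right _ _)
    · rw [add_comm (u t)]
      exact (key _ _ (hv t) (hu t) h).trans (by gcongr; exact le_max_left _ _)

/-- A positive constant factor does not matter on the logarithmic scale. -/
theorem tendsto_log_const_mul_div {β : Type*} {l : Filter β} {L u : β → ℝ} {c x : ℝ}
    (hL : Tendsto L l atTop) (hc : 0 < c) (hu : ∀ t, 0 < u t)
    (hx : Tendsto (fun t => Real.log (u t) / L t) l (𝓝 x)) :
    Tendsto (fun t => Real.log (c * u t) / L t) l (𝓝 x) := by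
  have h := (hL.const_div_atTop (Real.log c)).add hx
  rw [zero_add] at h
  refine h.congr fun t => ?_
  rw [Real.log_mul hc.ne' (hu t).ne', add_div]

theorem sum_rpow_div_sum_pos {ι : Type} {π : ι → ℝ} {S : Finset ι} (hS : S.Nonempty)
    (hπ : ∀ i ∈ S, 0 < π i) (α : ℝ) : 0 < ∑ i ∈ S, (π i / ∑ j ∈ S, π j) ^ α :=
  Finset.sum_pos (fun i hi => Real.rpow_pos_of_pos
    (div_pos (hπ i hi) (Finset.sum_pos hπ hS)) _) hS

theorem Dcost_pos {ι : Type} {π : ι → ℝ} {S : Finset ι} (hS : S.Nonempty)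
    (hπ : ∀ i ∈ S, 0 < π i) (α : ℝ) : 0 < Dcost π S α :=
  Real.rpow_pos_of_pos (sum_rpow_div_sum_pos hS hπ α) _

theorem tendsto_alphaOf : Tendsto alphaOf atTop (𝓝 0) :=
  (tendsto_atTop_add_const_left _ 1 (Real.tendsto_logb_atTop one_lt_two)).const_div_atTop 1

theorem tendsto_log_Dcost_alphaOf_div_log {ι : Type} {π : ι → ℝ} {S : Finset ι}
    (hS : S.Nonempty) (hπ : ∀ i ∈ S, 0 < π i) :
    Tendsto (fun lam : ℝ => Real.log (Dcost π S (alphaOf lam)) / Real.log lam) atTop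
      (𝓝 (Real.logb 2 S.card)) := by
  have hsum : Tendsto (fun lam => ∑ i ∈ S, (π i / ∑ j ∈ S, π j) ^ alphaOf lam) atTop
      (𝓝 S.card) := by
    have h : Tendsto (fun lam => ∑ i ∈ S, (π i / ∑ j ∈ S, π j) ^ alphaOf lam) atTop
        (𝓝 (∑ i ∈ S, (π i / ∑ j ∈ S, π j) ^ (0 : ℝ))) :=
      tendsto_finsetSum _ fun i hi => tendsto_const_nhds.rpow tendsto_alphaOf
        (Or.inl (div_pos (hπ i hi) (Finset.sum_pos hπ hS)).ne')
    simpa using h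
  have hlog := hsum.log (Nat.cast_ne_zero.mpr hS.card_pos.ne')
  have hcoef : Tendsto (fun lam : ℝ => 1 / Real.log lam + 1 / Real.log 2) atTop
      (𝓝 (0 + 1 / Real.log 2)) :=
    (Real.tendsto_log_atTop.const_div_atTop 1).add_const _
  have h := hcoef.mul hlog
  rw [zero_add, one_div_mul_eq_div, Real.log_div_log] at h
  refine h.congr' ?_
  filter_upwards [eventually_gt_atTop 1] with lam hlam
  have hl : Real.log lam ≠ 0 := (Real.log_pos hlam).ne'
  have h2 : Real.log 2 ≠ 0 := (Real.log_pos one_lt_two).ne'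
  rw [Dcost, Real.log_rpow (sum_rpow_div_sum_pos hS hπ _)]
  generalize Real.log (∑ i ∈ S, (π i / ∑ j ∈ S, π j) ^ alphaOf lam) = s
  rw [alphaOf, one_div_one_div, Real.logb]
  field_simp

/-- **Corollary (worst case, object identification).** For disjoint nonempty weighted sets
`A`, `B`, the node-splitting cost of `λ`-GBS satisfies
`lim_{λ→∞} log_λ((π_A/(π_A+π_B)) D_{α(λ)}(A) + (π_B/(π_A+π_B)) D_{α(λ)}(B))
  = max(log₂|A|, log₂|B|)`. -/
theorem lambda_gbs_worst_case_limit {ι : Type} [DecidableEq ι]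
    (A B : Finset ι) (hA : A.Nonempty) (hB : B.Nonempty) (hdisj : Disjoint A B)
    (π : ι → ℝ) (hπ : ∀ i ∈ A ∪ B, 0 < π i) :
    Filter.Tendsto
      (fun lam : ℝ =>
        Real.log
            ((∑ i ∈ A, π i) / ((∑ i ∈ A, π i) + (∑ i ∈ B, π i)) * Dcost π A (alphaOf lam)
              + (∑ i ∈ B, π i) / ((∑ i ∈ A, π i) + (∑ i ∈ B, π i)) * Dcost π B (alphaOf lam))
          / Real.log lam)
      Filter.atTop
      (nhds (max (Real.logb 2 (A.card : ℝ)) (Real.logb 2 (B.card : ℝ)))) := by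
  have hπA : ∀ i ∈ A, 0 < π i := fun i hi => hπ i (Finset.mem_union_left _ hi)
  have hπB : ∀ i ∈ B, 0 < π i := fun i hi => hπ i (Finset.mem_union_right _ hi)
  have hsA := Finset.sum_pos hπA hA
  have hsB := Finset.sum_pos hπB hB
  have hcA := div_pos hsA (add_pos hsA hsB)
  have hcB := div_pos hsB (add_pos hsA hsB)
  have hL := Real.tendsto_log_atTop
  exact tendsto_log_add_div_max hL
    (fun _ => mul_pos hcA (Dcost_pos hA hπA _)) (fun _ => mul_pos hcB (Dcost_pos hB hπB _))
    (tendsto_log_const_mul_div hL hcA (fun _ => Dcost_pos hA hπA _)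
      (tendsto_log_Dcost_alphaOf_div_log hA hπA))
    (tendsto_log_const_mul_div hL hcB (fun _ => Dcost_pos hB hπB _)
      (tendsto_log_Dcost_alphaOf_div_log hB hπB))
end

section
/- Let A and B be disjoint nonempty finite sets of objects with positive weights π_k and group labels y_k ∈ {1,…,m}; let π_A^i (resp. π_B^i) be the total weight of group-i objects in A (resp. B), π_A := Σ_i π_A^i, π_B := Σ_i π_B^i, and let N_A (resp. N_B) be the number of groups i with π_A^i > 0 (resp. π_B^i > 0). For λ > 1 set α(λ) := 1/(1 + log₂ λ). Then lim_{λ→∞} log_λ( (π_A/(π_A+π_B)) · (Σ_{i=1}^m (π_A^i/π_A)^{α(λ)})^{1/α(λ)} + (π_B/(π_A+π_B)) · (Σ_{i=1}^m (π_B^i/π_B)^{α(λ)})^{1/α(λ)} ) = max( log₂ N_A, log₂ N_B ). Consequently, in the limit λ → ∞, minimizing this node-splitting cost is equivalent to minimizing max(N_A, N_B), the larger number of groups sent to a child node. -/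
/-- The total weight of group-`i` objects in the set `S`: `π_S^i = ∑_{k ∈ S, y_k = i} π_k`. -/
noncomputable def groupMass {ι : Type} [DecidableEq ι] {m : ℕ}
    (π : ι → ℝ) (y : ι → Fin m) (S : Finset ι) (i : Fin m) : ℝ :=
  ∑ k ∈ S.filter (fun k => y k = i), π k

/-- The group Rényi diversity `D_α(S) = (∑_{i=1}^m (π_S^i/π_S)^α)^{1/α}` (with
`0^α = 0` for `α > 0`, so vanishing groups contribute 0). -/
noncomputable def groupDcost {ι : Type} [DecidableEq ι] {m : ℕ}
    (π : ι → ℝ) (y : ι → Fin m) (S : Finset ι) (α : ℝ) : ℝ :=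
  (∑ i : Fin m, (groupMass π y S i / ∑ k ∈ S, π k) ^ α) ^ (1 / α)

/-- The number of groups with positive mass in `S`. -/
noncomputable def numGroups {ι : Type} [DecidableEq ι] {m : ℕ}
    (π : ι → ℝ) (y : ι → Fin m) (S : Finset ι) : ℕ :=
  ((Finset.univ : Finset (Fin m)).filter (fun i => 0 < groupMass π y S i)).card

open Filter Topology in
/-- On a logarithmic scale, a sum of two positive functions grows like the larger one. -/
theorem tendsto_log_add_div_of_tendsto_log_div {κ : Type*} {l : Filter κ} {u v L : κ → ℝ} {a b : ℝ}
    (hL : Tendsto L l atTop) (hu : ∀ᶠ x in l, 0 < u x) (hv : ∀ᶠ x in l, 0 < v x)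
    (ha : Tendsto (fun x => Real.log (u x) / L x) l (𝓝 a))
    (hb : Tendsto (fun x => Real.log (v x) / L x) l (𝓝 b)) :
    Tendsto (fun x => Real.log (u x + v x) / L x) l (𝓝 (max a b)) := by
  have hmax := ha.max hb
  have hupper : Tendsto
      (fun x => Real.log 2 / L x + max (Real.log (u x) / L x) (Real.log (v x) / L x)) l
      (𝓝 (max a b)) := by
    simpa using (hL.const_div_atTop (Real.log 2)).add hmax
  refine tendsto_of_tendsto_of_tendsto_of_le_of_le' hmax hupper ?_ ?_
  · filter_upwards [hu, hv, hL.eventually_gt_atTop 0] with x hux hvx hLx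
    refine max_le ?_ ?_ <;> gcongr <;> linarith
  · filter_upwards [hu, hv, hL.eventually_gt_atTop 0] with x hux hvx hLx
    have key : ∀ w, 0 < w → u x + v x ≤ 2 * w →
        Real.log (u x + v x) / L x ≤ Real.log 2 / L x + Real.log w / L x := by
      intro w hw h
      rw [← add_div, ← Real.log_mul two_ne_zero hw.ne']
      gcongr
    rcases le_total (u x) (v x) with h | h
    · exact (key (v x) hvx (by linarith)).trans (by gcongr; exact le_max_right _ _)
    · exact (key (u x) hux (by linarith)).trans (by gcongr; exact le_max_left _ _)

open Filter Topology in
/-- As `α → 0⁺`, the power sum `∑ p_i ^ α` counts the positive `p_i`. -/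
theorem tendsto_sum_rpow_card_pos {κ : Type*} [Fintype κ] {p : κ → ℝ} (hp : ∀ i, 0 ≤ p i) :
    Tendsto (fun α : ℝ => ∑ i, p i ^ α) (𝓝[>] 0)
      (𝓝 ((Finset.univ.filter (fun i => 0 < p i)).card : ℝ)) := by
  rw [Finset.card_filter]
  push_cast
  refine tendsto_finsetSum _ fun i _ => ?_
  rcases (hp i).eq_or_lt with h | h
  · rw [← h, if_neg (lt_irrefl _)]
    refine tendsto_const_nhds.congr' ?_
    filter_upwards [self_mem_nhdsWithin] with α hα
    exact (Real.zero_rpow (ne_of_gt hα)).symm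
  · rw [if_pos h]
    have := (Real.continuous_const_rpow h.ne').tendsto 0
    rw [Real.rpow_zero] at this
    exact this.mono_left nhdsWithin_le_nhds

open Filter Topology in
theorem tendsto_alphaOf_atTop : Tendsto alphaOf atTop (𝓝[>] 0) := by
  have h : Tendsto (fun lam : ℝ => (1 + Real.logb 2 lam)⁻¹) atTop (𝓝[>] 0) :=
    tendsto_inv_atTop_nhdsGT_zero.comp
      (tendsto_atTop_add_const_left _ 1 (Real.tendsto_logb_atTop one_lt_two))
  exact h.congr fun lam => by rw [alphaOf, one_div]

theorem groupMass_nonneg {ι : Type} [DecidableEq ι] {m : ℕ} {S : Finset ι} {π : ι → ℝ}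
    (hπ : ∀ k ∈ S, 0 < π k) (y : ι → Fin m) (i : Fin m) : 0 ≤ groupMass π y S i :=
  Finset.sum_nonneg fun k hk => (hπ k (Finset.mem_filter.1 hk).1).le

theorem numGroups_pos {ι : Type} [DecidableEq ι] {m : ℕ} {S : Finset ι} (hS : S.Nonempty)
    {π : ι → ℝ} (hπ : ∀ k ∈ S, 0 < π k) (y : ι → Fin m) : 0 < numGroups π y S := by
  obtain ⟨k, hk⟩ := hS
  refine Finset.card_pos.2 ⟨y k, Finset.mem_filter.2 ⟨Finset.mem_univ _, ?_⟩⟩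
  exact Finset.sum_pos (fun j hj => hπ j (Finset.mem_filter.1 hj).1)
    ⟨k, Finset.mem_filter.2 ⟨hk, rfl⟩⟩

open Filter Topology in
/-- A positive multiple of the group Rényi diversity is eventually positive and, on the
`log_λ` scale, converges to the binary logarithm of the number of groups. -/
theorem tendsto_log_mul_groupDcost_div_log {ι : Type} [DecidableEq ι] {m : ℕ} {S : Finset ι}
    (hS : S.Nonempty) {π : ι → ℝ} (hπ : ∀ k ∈ S, 0 < π k) (y : ι → Fin m) {w : ℝ} (hw : 0 < w) :
    (∀ᶠ lam in atTop, 0 < w * groupDcost π y S (alphaOf lam)) ∧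
      Tendsto (fun lam => Real.log (w * groupDcost π y S (alphaOf lam)) / Real.log lam) atTop
        (𝓝 (Real.logb 2 (numGroups π y S : ℝ))) := by
  have hT : 0 < ∑ k ∈ S, π k := Finset.sum_pos hπ hS
  have hN : (0 : ℝ) < numGroups π y S := by exact_mod_cast numGroups_pos hS hπ y
  have hsum : Tendsto
      (fun lam => ∑ i : Fin m, (groupMass π y S i / ∑ k ∈ S, π k) ^ alphaOf lam) atTop
      (𝓝 (numGroups π y S : ℝ)) := by
    have h := (tendsto_sum_rpow_card_pos
      fun i => div_nonneg (groupMass_nonneg hπ y i) hT.le).comp tendsto_alphaOf_atTop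
    simp only [div_pos_iff_of_pos_right hT] at h
    exact h
  have hpos := hsum.eventually_const_lt hN
  refine ⟨?_, ?_⟩
  · filter_upwards [hpos] with lam h
    exact mul_pos hw (Real.rpow_pos_of_pos h _)
  · have hlim : Tendsto (fun lam => Real.log w / Real.log lam + (1 / Real.log lam + 1 / Real.log 2) *
        Real.log (∑ i : Fin m, (groupMass π y S i / ∑ k ∈ S, π k) ^ alphaOf lam)) atTop
        (𝓝 (Real.logb 2 (numGroups π y S : ℝ))) := by
      have h := (Real.tendsto_log_atTop.const_div_atTop (Real.log w)).add
        (((Real.tendsto_log_atTop.const_div_atTop 1).add_const (1 / Real.log 2)).mul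
          (hsum.log hN.ne'))
      convert h using 2
      rw [Real.logb]
      ring
    refine hlim.congr' ?_
    filter_upwards [hpos, eventually_gt_atTop 1] with lam h hlam
    have hlog : Real.log lam ≠ 0 := (Real.log_pos hlam).ne'
    have hlog2 : Real.log 2 ≠ 0 := (Real.log_pos one_lt_two).ne'
    rw [groupDcost, Real.log_mul hw.ne' (Real.rpow_pos_of_pos h _).ne', Real.log_rpow h]
    generalize Real.log (∑ i : Fin m, (groupMass π y S i / ∑ k ∈ S, π k) ^ alphaOf lam) = s
    rw [alphaOf, Real.logb, one_div_one_div]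
    field_simp

/-- **Corollary (worst case, group identification).** For disjoint nonempty weighted sets
`A`, `B` with group labels, the node-splitting cost of `λ`-GGBS satisfies
`lim_{λ→∞} log_λ((π_A/(π_A+π_B)) D_{α(λ)}(A) + (π_B/(π_A+π_B)) D_{α(λ)}(B))
  = max(log₂ N_A, log₂ N_B)`, where `N_A`, `N_B` are the numbers of groups present
in `A` and `B`. -/
theorem lambda_ggbs_worst_case_limit {ι : Type} [DecidableEq ι] {m : ℕ}
    (A B : Finset ι) (hA : A.Nonempty) (hB : B.Nonempty) (hdisj : Disjoint A B)
    (π : ι → ℝ) (hπ : ∀ k ∈ A ∪ B, 0 < π k) (y : ι → Fin m) :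
    Filter.Tendsto
      (fun lam : ℝ =>
        Real.log
            ((∑ k ∈ A, π k) / ((∑ k ∈ A, π k) + (∑ k ∈ B, π k)) * groupDcost π y A (alphaOf lam)
              + (∑ k ∈ B, π k) / ((∑ k ∈ A, π k) + (∑ k ∈ B, π k)) * groupDcost π y B (alphaOf lam))
          / Real.log lam)
      Filter.atTop
      (nhds (max (Real.logb 2 (numGroups π y A : ℝ)) (Real.logb 2 (numGroups π y B : ℝ)))) := by
  have hπA : ∀ k ∈ A, 0 < π k := fun k hk => hπ k (Finset.mem_union_left _ hk)
  have hπB : ∀ k ∈ B, 0 < π k := fun k hk => hπ k (Finset.mem_union_right _ hk)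
  have hTA : 0 < ∑ k ∈ A, π k := Finset.sum_pos hπA hA
  have hTB : 0 < ∑ k ∈ B, π k := Finset.sum_pos hπB hB
  obtain ⟨hpA, hlA⟩ :=
    tendsto_log_mul_groupDcost_div_log hA hπA y (div_pos hTA (add_pos hTA hTB))
  obtain ⟨hpB, hlB⟩ :=
    tendsto_log_mul_groupDcost_div_log hB hπB y (div_pos hTB (add_pos hTA hTB))
  exact tendsto_log_add_div_of_tendsto_log_div Real.tendsto_log_atTop hpA hpB hlA hlB
end

section
/- For any real number λ and any full binary tree T with nonnegative weights w_j on its leaves, the following identity holds: Σ_{j ∈ leaves} w_j · (Σ_{k=0}^{d_j − 1} λ^k) = Σ_{a ∈ I} λ^{d_a} W_a, where W_a is the total weight of the leaves in the subtree rooted at internal node a. In particular, for λ > 1, (1/(λ−1)) ( Σ_{j ∈ leaves} w_j λ^{d_j} − W_root ) = Σ_{a ∈ I} λ^{d_a} W_a. -/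
/-- A full binary tree whose leaves carry real weights. -/
inductive WTree : Type where
  | leaf : ℝ → WTree
  | node : WTree → WTree → WTree

namespace WTree

/-- The list of leaf weights of a tree. -/
def leaves : WTree → List ℝ
  | .leaf w => [w]
  | .node l r => leaves l ++ leaves r

/-- The list of leaf weights together with their depths (root has depth 0). -/
def leavesD : WTree → List (ℝ × ℕ)
  | .leaf w => [(w, 0)]
  | .node l r => (leavesD l ++ leavesD r).map fun p => (p.1, p.2 + 1)

/-- The list of internal nodes (as subtrees) together with their depths. -/
def internals : WTree → List (WTree × ℕ)
  | .leaf _ => []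
  | .node l r => (.node l r, 0) :: ((internals l ++ internals r).map fun p => (p.1, p.2 + 1))

end WTree

namespace WTree

theorem map_fst_leavesD (T : WTree) : T.leavesD.map Prod.fst = T.leaves := by
  induction T with
  | leaf w => rfl
  | node l r ihl ihr => simp [leavesD, leaves, ← ihl, ← ihr, Function.comp_def]

/-- Moving all leaves one level down. -/
theorem sum_mul_geom_succ (L : List (ℝ × ℕ)) (x : ℝ) :
    (L.map fun p => p.1 * ∑ k ∈ Finset.range (p.2 + 1), x ^ k).sum
      = (L.map Prod.fst).sum + x * (L.map fun p => p.1 * ∑ k ∈ Finset.range p.2, x ^ k).sum := by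
  rw [← List.sum_map_mul_left, ← List.sum_map_add]
  congr 2 with p
  rw [geom_sum_succ]
  ring

theorem sum_pow_succ_mul (L : List (WTree × ℕ)) (x : ℝ) :
    (L.map fun p => x ^ (p.2 + 1) * p.1.leaves.sum).sum
      = x * (L.map fun p => x ^ p.2 * p.1.leaves.sum).sum := by
  rw [← List.sum_map_mul_left]
  congr 2 with p
  ring

theorem sum_leavesD_mul_geom (T : WTree) (x : ℝ) :
    (T.leavesD.map fun p => p.1 * ∑ k ∈ Finset.range p.2, x ^ k).sum
      = (T.internals.map fun p => x ^ p.2 * p.1.leaves.sum).sum := by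
  induction T with
  | leaf w => simp [leavesD, internals]
  | node l r ihl ihr =>
    simp only [leavesD, internals, List.map_map, Function.comp_def, List.map_cons, List.sum_cons,
      sum_mul_geom_succ, sum_pow_succ_mul, List.map_append, List.sum_append, ihl, ihr,
      map_fst_leavesD, leaves, pow_zero, one_mul]
    ring

/-- Telescoping the geometric sums in the weighted depth sum. -/
theorem sub_one_mul_sum_leavesD (T : WTree) (x : ℝ) :
    (x - 1) * (T.leavesD.map fun p => p.1 * ∑ k ∈ Finset.range p.2, x ^ k).sum
      = (T.leavesD.map fun p => p.1 * x ^ p.2).sum - T.leaves.sum := by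
  rw [← map_fst_leavesD, ← List.sum_map_mul_left, eq_sub_iff_add_eq, ← List.sum_map_add]
  congr 2 with p
  linear_combination p.1 * mul_geom_sum x p.2

end WTree

/-- **Lemma (depth-sum decomposition).** For any real `λ` and any full binary tree with
nonnegative leaf weights, `∑_{j ∈ leaves} w_j (∑_{k=0}^{d_j-1} λ^k) = ∑_{a ∈ I} λ^{d_a} W_a`,
where `W_a` is the total leaf weight of the subtree rooted at `a`.  In particular, for
`λ > 1`, `(1/(λ-1)) (∑_j w_j λ^{d_j} - W_root) = ∑_{a ∈ I} λ^{d_a} W_a`. -/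
theorem depth_sum_decomposition (T : WTree) (hw : ∀ w ∈ T.leaves, 0 ≤ w) (lam : ℝ) :
    (T.leavesD.map fun p => p.1 * ∑ k ∈ Finset.range p.2, lam ^ k).sum
      = (T.internals.map fun p => lam ^ p.2 * p.1.leaves.sum).sum
    ∧ (1 < lam →
        (1 / (lam - 1)) * ((T.leavesD.map fun p => p.1 * lam ^ p.2).sum - T.leaves.sum)
          = (T.internals.map fun p => lam ^ p.2 * p.1.leaves.sum).sum) := by
  refine ⟨T.sum_leavesD_mul_geom lam, fun hlam => ?_⟩
  rw [← T.sub_one_mul_sum_leavesD, T.sum_leavesD_mul_geom, ← mul_assoc,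
    one_div_mul_cancel (sub_ne_zero.mpr hlam.ne'), one_mul]
end
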